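/- arXiv:0705.2287 — 2 statements merged into one kernel-verified Lean document; each statement's English description precedes it below -/
import Mathlib

section
/- Keller–Osserman type upper bound without boundary condition: Let p > 1 and β := 2p/(p−1). There exists a positive constant N₂ depending only on n, λ, Λ, K, p and diam Ω such that every u ∈ C²(Ω) satisfying Lu(x) = (u(x))₊^p for all x ∈ Ω (no boundary condition imposed) obeys (u(x))₊^p ≤ N₂ d(x)^{−β} for all x ∈ Ω. -/
open Metric Set Filter Real Bornology

/-- First-order partial derivative `D_i u (x)`. -/
noncomputable def pd {n : ℕ} (u : EuclideanSpace ℝ (Fin n) → ℝ) (i : Fin n)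
    (x : EuclideanSpace ℝ (Fin n)) : ℝ :=
  fderiv ℝ u x (EuclideanSpace.single i 1)

/-- Second-order partial derivative `D_{ij} u (x)`. -/
noncomputable def pd2 {n : ℕ} (u : EuclideanSpace ℝ (Fin n) → ℝ) (i j : Fin n)
    (x : EuclideanSpace ℝ (Fin n)) : ℝ :=
  fderiv ℝ (fun y => fderiv ℝ u y (EuclideanSpace.single j 1)) x (EuclideanSpace.single i 1)

/-- The operator `L u = a^{ij} D_{ij} u + b^i D_i u - c u`. -/
noncomputable def Lop {n : ℕ} (a : EuclideanSpace ℝ (Fin n) → Fin n → Fin n → ℝ)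
    (b : EuclideanSpace ℝ (Fin n) → Fin n → ℝ) (c : EuclideanSpace ℝ (Fin n) → ℝ)
    (u : EuclideanSpace ℝ (Fin n) → ℝ) (x : EuclideanSpace ℝ (Fin n)) : ℝ :=
  (∑ i, ∑ j, a x i j * pd2 u i j x) + (∑ i, b x i * pd u i x) - c x * u x

/-- The standing assumptions on the coefficients of `L`: measurability, symmetry,
`Σ (b^i)² ≤ K`, `0 ≤ c ≤ K`, `K > 0`, and uniform ellipticity `λ|ξ|² ≤ aᵢⱼξᵢξⱼ ≤ Λ|ξ|²`
with `0 < λ ≤ Λ`. -/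
def CoeffsOK {n : ℕ} (a : EuclideanSpace ℝ (Fin n) → Fin n → Fin n → ℝ)
    (b : EuclideanSpace ℝ (Fin n) → Fin n → ℝ) (c : EuclideanSpace ℝ (Fin n) → ℝ)
    (K lam Lam : ℝ) : Prop :=
  (∀ i j, Measurable fun x => a x i j) ∧ (∀ i, Measurable fun x => b x i) ∧
  Measurable c ∧ (∀ x i j, a x i j = a x j i) ∧
  (∀ x, ∑ i, (b x i) ^ 2 ≤ K) ∧ (∀ x, 0 ≤ c x ∧ c x ≤ K) ∧
  0 < K ∧ 0 < lam ∧ lam ≤ Lam ∧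
  (∀ x (ξ : EuclideanSpace ℝ (Fin n)),
    lam * ‖ξ‖ ^ 2 ≤ ∑ i, ∑ j, a x i j * ξ i * ξ j ∧
    ∑ i, ∑ j, a x i j * ξ i * ξ j ≤ Lam * ‖ξ‖ ^ 2)

/-- `u(x) → +∞` as `d(x) := dist(x, ∂Ω) → 0`. -/
def BlowsUp {n : ℕ} (Ω : Set (EuclideanSpace ℝ (Fin n)))
    (u : EuclideanSpace ℝ (Fin n) → ℝ) : Prop :=
  ∀ M : ℝ, ∃ δ > 0, ∀ x ∈ Ω, infDist x (frontier Ω) < δ → M ≤ u x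

/-- One-dimensional second derivative test. -/
theorem aux_second_le (h h' : ℝ → ℝ) (k : ℝ)
    (hh : ∀ᶠ t in nhds (0:ℝ), HasDerivAt h (h' t) t)
    (hk : HasDerivAt h' k 0) (hmax : IsLocalMax h 0) : k ≤ 0 := by
  by_contra hpos
  push Not at hpos
  set g : ℝ → ℝ := fun t => h t - (k / 4) * t ^ 2 with hg
  have hgd : ∀ᶠ t in nhds (0:ℝ), HasDerivAt g (h' t - (k / 2) * t) t := by
    filter_upwards [hh] with t ht
    have h2 : HasDerivAt (fun t : ℝ => (k / 4) * t ^ 2) ((k / 4) * (2 * t)) t := by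
      simpa using (hasDerivAt_pow 2 t).const_mul (k / 4)
    have := ht.sub h2
    refine this.congr_deriv ?_
    ring
  have hder : deriv g =ᶠ[nhds 0] fun t => h' t - (k / 2) * t := by
    filter_upwards [hgd] with t ht using ht.deriv
  have hd2 : HasDerivAt (fun t => h' t - (k / 2) * t) (k - k / 2) 0 := by
    have := hk.sub ((hasDerivAt_id (0:ℝ)).const_mul (k / 2))
    exact this.congr_deriv (by simp)
  have hh0 : h' 0 = 0 := hmax.hasDerivAt_eq_zero hh.self_of_nhds
  have hmin : IsLocalMin g 0 := by
    apply isLocalMin_of_deriv_deriv_pos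
    · rw [hder.deriv_eq, hd2.deriv]; linarith
    · rw [hder.self_of_nhds]; simp [hh0]
    · exact hgd.self_of_nhds.continuousAt
  have hev : ∀ᶠ t in nhds (0:ℝ), t = 0 := by
    filter_upwards [hmin, hmax] with t h1 h2
    by_contra hne
    have : 0 < t ^ 2 := by positivity
    simp only [hg] at h1
    nlinarith
  obtain ⟨ε, hε, hball⟩ := Metric.eventually_nhds_iff.1 hev
  have := @hball (ε / 2) (by rw [Real.dist_eq]; rw [abs_of_pos] <;> linarith)
  linarith

theorem aux_expand {n : ℕ} (ξ : EuclideanSpace ℝ (Fin n)) :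
    ξ = ∑ i, ξ i • EuclideanSpace.single i (1:ℝ) := by
  ext j
  simp [Finset.sum_apply, Pi.single_apply]

theorem aux_line {n : ℕ} (u : EuclideanSpace ℝ (Fin n) → ℝ) (y ξ : EuclideanSpace ℝ (Fin n))
    (hu : ContDiffAt ℝ 2 u y) :
    (∀ᶠ t in nhds (0:ℝ), HasDerivAt (fun t : ℝ => u (y + t • ξ)) (fderiv ℝ u (y + t • ξ) ξ) t) ∧
    HasDerivAt (fun t : ℝ => fderiv ℝ u (y + t • ξ) ξ) (∑ i, ∑ j, pd2 u i j y * ξ i * ξ j) 0 ∧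
    fderiv ℝ u y ξ = ∑ i, pd u i y * ξ i := by
  have hline : ∀ t : ℝ, HasDerivAt (fun t : ℝ => y + t • ξ) ξ t := by
    intro t
    simpa using ((hasDerivAt_id t).smul_const ξ).const_add y
  have hD : DifferentiableAt ℝ (fderiv ℝ u) y :=
    (hu.fderiv_right (m := 1) (by norm_num)).differentiableAt (by norm_num)
  refine ⟨?_, ?_, ?_⟩
  · have h1 : ∀ᶠ x in nhds y, ContDiffAt ℝ 2 u x := hu.eventually (by simp)
    have h2 : Filter.Tendsto (fun t : ℝ => y + t • ξ) (nhds 0) (nhds y) := by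
      have := (hline 0).continuousAt.tendsto
      simpa using this
    filter_upwards [h2.eventually h1] with t ht
    exact (ht.differentiableAt (by norm_num)).hasFDerivAt.comp_hasDerivAt t (hline t)
  · have hpd : ∀ i j, pd2 u i j y = fderiv ℝ (fderiv ℝ u) y (EuclideanSpace.single i 1)
        (EuclideanSpace.single j 1) := by
      intro i j
      unfold pd2
      rw [fderiv_clm_apply hD (differentiableAt_const _)]
      simp
    have h3 : HasDerivAt (fun t : ℝ => fderiv ℝ u (y + t • ξ)) (fderiv ℝ (fderiv ℝ u) y ξ) 0 := by
      have hD' : HasFDerivAt (fderiv ℝ u) (fderiv ℝ (fderiv ℝ u) y) (y + (0:ℝ) • ξ) := by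
        simpa using hD.hasFDerivAt
      exact hD'.comp_hasDerivAt (0:ℝ) (hline 0)
    have h4 := h3.clm_apply (hasDerivAt_const (0:ℝ) ξ)
    refine h4.congr_deriv ?_
    symm
    simp only [map_zero, add_zero]
    conv_rhs => rw [aux_expand ξ]
    simp only [map_sum, map_smul, _root_.sum_apply, _root_.smul_apply,
      smul_eq_mul, hpd, Finset.mul_sum]
    rw [Finset.sum_comm]
    refine Finset.sum_congr rfl fun i _ => Finset.sum_congr rfl fun j _ => by ring
  · conv_lhs => rw [aux_expand ξ]
    simp only [map_sum, map_smul, smul_eq_mul, pd]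
    exact Finset.sum_congr rfl fun i _ => by ring

theorem aux_trace {n : ℕ} (a Q : Fin n → Fin n → ℝ) (hs : ∀ i j, a i j = a j i)
    (ha : ∀ ξ : EuclideanSpace ℝ (Fin n), 0 ≤ ∑ i, ∑ j, a i j * ξ i * ξ j)
    (hQ : ∀ ξ : EuclideanSpace ℝ (Fin n), 0 ≤ ∑ i, ∑ j, Q i j * ξ i * ξ j) :
    0 ≤ ∑ i, ∑ j, a i j * Q i j := by
  have hps : (Matrix.of a).PosSemidef := by
    apply Matrix.PosSemidef.of_dotProduct_mulVec_nonneg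
    · ext i j
      simp [hs j i]
    · intro x
      have := ha (WithLp.toLp 2 x)
      simp only [dotProduct, Matrix.mulVec, Matrix.of_apply, Finset.mul_sum]
      refine this.trans_eq (Finset.sum_congr rfl fun i _ => Finset.sum_congr rfl fun j _ => ?_)
      simp
      ring
  obtain ⟨m, B, hB⟩ := Matrix.posSemidef_iff_eq_sum_vecMulVec.1 hps
  have haB : ∀ i j, a i j = ∑ k, B k i * B k j := by
    intro i j
    have := congrFun (congrFun hB i) j
    simpa [Matrix.sum_apply, Matrix.vecMulVec_apply] using this
  have : ∑ i, ∑ j, a i j * Q i j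
      = ∑ k, ∑ i, ∑ j, Q i j * (WithLp.toLp 2 (B k) : EuclideanSpace ℝ (Fin n)) i *
        (WithLp.toLp 2 (B k) : EuclideanSpace ℝ (Fin n)) j := by
    simp only [haB, Finset.sum_mul]
    conv_rhs => rw [Finset.sum_comm]
    refine Finset.sum_congr rfl fun i _ => ?_
    conv_rhs => rw [Finset.sum_comm]
    refine Finset.sum_congr rfl fun j _ => Finset.sum_congr rfl fun k _ => ?_
    ring
  rw [this]
  exact Finset.sum_nonneg fun k _ => hQ _

/-- The barrier along a line. -/
theorem aux_barrier {n : ℕ} (x0 y ξ : EuclideanSpace ℝ (Fin n)) (r γ M : ℝ)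
    (hφ : 0 < r ^ 2 - ‖y - x0‖ ^ 2) :
    (∀ᶠ t in nhds (0:ℝ), 0 < r ^ 2 - ‖y + t • ξ - x0‖ ^ 2 ∧
      HasDerivAt (fun t : ℝ => M * (r ^ 2 - ‖y + t • ξ - x0‖ ^ 2) ^ (-γ))
      (2 * γ * M * (r ^ 2 - ‖y + t • ξ - x0‖ ^ 2) ^ (-γ - 1) * (inner ℝ (y - x0) ξ + t * ‖ξ‖ ^ 2)) t)
    ∧ HasDerivAt (fun t : ℝ => 2 * γ * M * (r ^ 2 - ‖y + t • ξ - x0‖ ^ 2) ^ (-γ - 1) *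
        (inner ℝ (y - x0) ξ + t * ‖ξ‖ ^ 2))
      (4 * γ * (γ + 1) * (M * (r ^ 2 - ‖y - x0‖ ^ 2) ^ (-γ - 2)) * (inner ℝ (y - x0) ξ) ^ 2
        + 2 * γ * M * (r ^ 2 - ‖y - x0‖ ^ 2) ^ (-γ - 1) * ‖ξ‖ ^ 2) 0 := by
  have hn : ∀ t : ℝ, ‖y + t • ξ - x0‖ ^ 2
      = ‖y - x0‖ ^ 2 + 2 * t * inner ℝ (y - x0) ξ + t ^ 2 * ‖ξ‖ ^ 2 := by
    intro t
    have : y + t • ξ - x0 = (y - x0) + t • ξ := by abel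
    rw [this, norm_add_sq_real, inner_smul_right, norm_smul, mul_pow, Real.norm_eq_abs, sq_abs]
    ring
  simp only [hn]
  set I : ℝ := inner ℝ (y - x0) ξ
  set X : ℝ := ‖ξ‖ ^ 2
  set Z : ℝ := ‖y - x0‖ ^ 2
  have hdφ : ∀ t : ℝ, HasDerivAt (fun t : ℝ => r ^ 2 - (Z + 2 * t * I + t ^ 2 * X))
      (-2 * (I + t * X)) t := by
    intro t
    have h1 : HasDerivAt (fun t : ℝ => 2 * t * I) (2 * I) t := by
      simpa using ((hasDerivAt_id t).const_mul 2).mul_const I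
    have h2 : HasDerivAt (fun t : ℝ => t ^ 2 * X) (2 * t * X) t := by
      simpa using (hasDerivAt_pow 2 t).mul_const X
    have := ((h1.const_add Z).add h2).const_sub (r ^ 2)
    refine this.congr_deriv ?_
    ring
  have hev : ∀ᶠ t in nhds (0:ℝ), 0 < r ^ 2 - (Z + 2 * t * I + t ^ 2 * X) := by
    apply (hdφ 0).continuousAt.eventually_const_lt
    simpa using hφ
  refine ⟨?_, ?_⟩
  · filter_upwards [hev] with t ht
    refine ⟨ht, ?_⟩
    have := ((hdφ t).rpow_const (p := -γ) (Or.inl ht.ne')).const_mul M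
    refine this.congr_deriv ?_
    ring
  · have h0 : 0 < r ^ 2 - (Z + 2 * 0 * I + 0 ^ 2 * X) := by simpa using hφ
    have h1 := ((hdφ 0).rpow_const (p := -γ - 1) (Or.inl h0.ne')).const_mul (2 * γ * M)
    have h2 : HasDerivAt (fun t : ℝ => I + t * X) X 0 := by
      simpa using ((hasDerivAt_id (0:ℝ)).mul_const X).const_add I
    have := h1.mul h2
    refine this.congr_deriv ?_
    have e : -γ - 1 - 1 = -γ - 2 := by ring
    rw [e]
    simp
    ring

theorem aux_sum_ineq {n : ℕ} (A : Fin n → Fin n → ℝ) (b : Fin n → ℝ) (c : ℝ)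
    (K lam Lam : ℝ) (hlam : 0 < lam) (hs : ∀ i j, A i j = A j i) (hb : ∑ i, (b i) ^ 2 ≤ K)
    (hA : ∀ ξ : EuclideanSpace ℝ (Fin n), lam * ‖ξ‖ ^ 2 ≤ ∑ i, ∑ j, A i j * ξ i * ξ j ∧
      ∑ i, ∑ j, A i j * ξ i * ξ j ≤ Lam * ‖ξ‖ ^ 2)
    (H : Fin n → Fin n → ℝ) (g : Fin n → ℝ) (z : EuclideanSpace ℝ (Fin n)) (S P : ℝ)
    (hS : 0 ≤ S) (hP : 0 ≤ P)
    (hH : ∀ ξ : EuclideanSpace ℝ (Fin n), ∑ i, ∑ j, H i j * ξ i * ξ j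
      ≤ S * (inner ℝ z ξ) ^ 2 + P * ‖ξ‖ ^ 2)
    (hg : ∀ i, g i = P * z i) :
    (∑ i, ∑ j, A i j * H i j) + ∑ i, b i * g i ≤ S * (Lam * ‖z‖ ^ 2) + P * (n * Lam)
      + P * (√K * ‖z‖) := by
  have hin : ∀ ξ : EuclideanSpace ℝ (Fin n), inner ℝ z ξ = ∑ i, z i * ξ i := by
    intro ξ
    simp [PiLp.inner_apply, mul_comm]
  have hnn : ∀ ξ : EuclideanSpace ℝ (Fin n), ‖ξ‖ ^ 2 = ∑ i, ξ i ^ 2 := by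
    intro ξ
    simp [EuclideanSpace.norm_sq_eq]
  have h1 := aux_trace A (fun i j => S * (z i * z j) + P * (if i = j then 1 else 0) - H i j) hs
    (fun ξ => le_trans (by positivity) (hA ξ).1) (by
      intro ξ
      have e : ∑ i, ∑ j, (S * (z i * z j) + P * (if i = j then 1 else 0) - H i j) * ξ i * ξ j
          = S * (inner ℝ z ξ) ^ 2 + P * ‖ξ‖ ^ 2 - ∑ i, ∑ j, H i j * ξ i * ξ j := by
        have e1 : ∑ i, ∑ j, S * (z i * z j) * ξ i * ξ j = S * (inner ℝ z ξ) ^ 2 := by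
          rw [hin, sq, Finset.sum_mul_sum]
          simp only [Finset.mul_sum]
          refine Finset.sum_congr rfl fun i _ => Finset.sum_congr rfl fun j _ => by ring
        have e2 : ∑ i, ∑ j, P * (if i = j then (1:ℝ) else 0) * ξ i * ξ j = P * ‖ξ‖ ^ 2 := by
          rw [hnn]
          simp only [Finset.mul_sum]
          refine Finset.sum_congr rfl fun i _ => ?_
          simp
          ring
        rw [← e1, ← e2]
        simp only [← Finset.sum_add_distrib, ← Finset.sum_sub_distrib]
        refine Finset.sum_congr rfl fun i _ => Finset.sum_congr rfl fun j _ => by ring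
      rw [e]
      linarith [hH ξ])
  have h2 : ∑ i, ∑ j, A i j * (S * (z i * z j) + P * (if i = j then 1 else 0) - H i j)
      = S * (∑ i, ∑ j, A i j * z i * z j) + P * (∑ i, A i i) - ∑ i, ∑ j, A i j * H i j := by
    have e2 : P * (∑ i, A i i) = ∑ i, ∑ j, P * (A i j * if i = j then 1 else 0) := by
      rw [Finset.mul_sum]
      refine Finset.sum_congr rfl fun i _ => ?_
      simp
    rw [e2]
    simp only [Finset.mul_sum]
    simp only [← Finset.sum_add_distrib, ← Finset.sum_sub_distrib]
    refine Finset.sum_congr rfl fun i _ => Finset.sum_congr rfl fun j _ => by ring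
  rw [h2] at h1
  have h3 : ∑ i, A i i ≤ n * Lam := by
    have : ∀ i ∈ Finset.univ, A i i ≤ Lam := by
      intro i _
      have := (hA (EuclideanSpace.single i 1)).2
      simpa [Pi.single_apply] using this
    simpa using Finset.sum_le_card_nsmul _ _ _ this
  have h4 := (hA z).2
  have h5 : ∑ i, b i * z i ≤ √K * ‖z‖ := by
    refine (Real.sum_mul_le_sqrt_mul_sqrt _ _ _).trans ?_
    rw [← hnn z, Real.sqrt_sq (norm_nonneg _)]
    gcongr
  have h6 : ∑ i, b i * g i = P * ∑ i, b i * z i := by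
    rw [Finset.mul_sum]
    exact Finset.sum_congr rfl fun i _ => by rw [hg]; ring
  rw [h6]
  have := mul_le_mul_of_nonneg_left h4 hS
  have := mul_le_mul_of_nonneg_left h3 hP
  have := mul_le_mul_of_nonneg_left h5 hP
  linarith

/-- Final computation with powers. -/
theorem aux_final (p : ℝ) (hp : 1 < p) (C r M φ U u0 : ℝ) (hC : 0 < C) (hr : 0 < r) (hM : 0 < M)
    (hφ : 0 < φ) (hU : U = M * φ ^ (-(2 / (p - 1))))
    (h : U ^ p ≤ M * φ ^ (-(2 / (p - 1)) - 2) * (C * r ^ 2))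
    (hu0 : 0 < u0) (h0 : u0 * (r ^ 2) ^ (2 / (p - 1)) ≤ M) :
    u0 ^ p ≤ C ^ (p / (p - 1)) / r ^ (2 * p / (p - 1)) := by
  have hp1 : 0 < p - 1 := by linarith
  have e1 : U ^ p = M ^ p * φ ^ (-(2 / (p - 1)) - 2) := by
    rw [hU, Real.mul_rpow hM.le (by positivity), ← Real.rpow_mul hφ.le]
    congr 2
    field_simp
    ring
  rw [e1] at h
  have h1 : M ^ (p - 1) ≤ C * r ^ 2 := by
    have e2 : M ^ p = M * M ^ (p - 1) := by
      rw [Real.rpow_sub_one hM.ne']; field_simp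
    rw [e2] at h
    have hpos : 0 < M * φ ^ (-(2 / (p - 1)) - 2) := by positivity
    refine le_of_mul_le_mul_left ?_ hpos
    linarith
  have h2 : M ^ p ≤ C ^ (p / (p - 1)) * r ^ (2 * p / (p - 1)) := by
    have := Real.rpow_le_rpow (by positivity) h1 (z := p / (p - 1)) (by positivity)
    rw [← Real.rpow_mul hM.le, Real.mul_rpow hC.le (by positivity), ← Real.rpow_natCast r 2,
      ← Real.rpow_mul hr.le] at this
    convert this using 2
    · field_simp
    · congr 1
      push_cast
      ring
  have h3 := Real.rpow_le_rpow (by positivity) h0 (z := p) (by positivity)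
  rw [Real.mul_rpow hu0.le (by positivity), ← Real.rpow_mul (by positivity),
    ← Real.rpow_natCast r 2, ← Real.rpow_mul hr.le] at h3
  have e3 : ((2:ℕ):ℝ) * (2 / (p - 1) * p) = 2 * p / (p - 1) + 2 * p / (p - 1) := by
    push_cast
    ring
  rw [e3, Real.rpow_add hr] at h3
  have hb : 0 < r ^ (2 * p / (p - 1)) := by positivity
  rw [le_div_iff₀ hb]
  refine le_of_mul_le_mul_right ?_ hb
  linarith

theorem aux_key {n : ℕ} (hn : 2 ≤ n) (K lam Lam : ℝ) (hK : 0 < K) (hlam : 0 < lam)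
    (hlL : lam ≤ Lam) (p : ℝ) (hp : 1 < p) (x0 : EuclideanSpace ℝ (Fin n)) (r D : ℝ)
    (hr : 0 < r) (hrD : r ≤ D)
    (a : EuclideanSpace ℝ (Fin n) → Fin n → Fin n → ℝ)
    (b : EuclideanSpace ℝ (Fin n) → Fin n → ℝ)
    (c : EuclideanSpace ℝ (Fin n) → ℝ) (hco : CoeffsOK a b c K lam Lam)
    (u : EuclideanSpace ℝ (Fin n) → ℝ) (hu : ∀ x ∈ closedBall x0 r, ContDiffAt ℝ 2 u x)
    (hL : ∀ x ∈ closedBall x0 r, Lop a b c u x = (max (u x) 0) ^ p) (hu0 : 0 < u x0) :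
    u x0 ^ p ≤ (4 * (2 / (p - 1)) * (2 / (p - 1) + 1) * Lam + 2 * (2 / (p - 1)) * (n * Lam)
      + 2 * (2 / (p - 1)) * (√K * D)) ^ (p / (p - 1)) / r ^ (2 * p / (p - 1)) := by
  obtain ⟨-, -, -, hs, hb, hc, -, -, -, hA⟩ := hco
  have hp1 : 0 < p - 1 := by linarith
  have hLam : 0 < Lam := by linarith
  have hγ : 0 < 2 / (p - 1) := by positivity
  set γ := 2 / (p - 1) with hγd
  have hcont : ContinuousOn (fun x => u x * (r ^ 2 - ‖x - x0‖ ^ 2) ^ γ) (closedBall x0 r) := by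
    apply ContinuousOn.mul
    · exact fun x hx => (hu x hx).continuousAt.continuousWithinAt
    · apply Continuous.continuousOn
      apply Continuous.rpow_const (by fun_prop)
      exact fun _ => Or.inr hγ.le
  obtain ⟨y, hy, hmax⟩ := (isCompact_closedBall x0 r).exists_isMaxOn
    ⟨x0, mem_closedBall_self hr.le⟩ hcont
  set M := u y * (r ^ 2 - ‖y - x0‖ ^ 2) ^ γ with hMd
  have h0 : u x0 * (r ^ 2) ^ γ ≤ M := by
    have := hmax (mem_closedBall_self hr.le)
    simpa using this
  have hM : 0 < M := lt_of_lt_of_le (by positivity) h0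
  have hyr : ‖y - x0‖ ≤ r := by simpa [dist_eq_norm] using hy
  have hφ0 : 0 ≤ r ^ 2 - ‖y - x0‖ ^ 2 := by nlinarith [norm_nonneg (y - x0)]
  have hφ : 0 < r ^ 2 - ‖y - x0‖ ^ 2 := by
    rcases hφ0.eq_or_lt with h | h
    · rw [hMd, ← h, Real.zero_rpow hγ.ne'] at hM
      simp at hM
    · exact h
  have hlt : ‖y - x0‖ < r := by nlinarith [norm_nonneg (y - x0)]
  have huy : u y = M * (r ^ 2 - ‖y - x0‖ ^ 2) ^ (-γ) := by
    rw [hMd, mul_assoc, ← Real.rpow_add hφ]; simp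
  have huypos : 0 < u y := by rw [huy]; positivity
  set φ := r ^ 2 - ‖y - x0‖ ^ 2 with hφd
  set P := 2 * γ * M * φ ^ (-γ - 1) with hP
  set S := 4 * γ * (γ + 1) * (M * φ ^ (-γ - 2)) with hS
  have hPpos : 0 < P := by positivity
  have hSpos : 0 < S := by positivity
  have hkey : ∀ ξ : EuclideanSpace ℝ (Fin n),
      (∑ i, ∑ j, pd2 u i j y * ξ i * ξ j ≤ S * (inner ℝ (y - x0) ξ) ^ 2 + P * ‖ξ‖ ^ 2) ∧
      fderiv ℝ u y ξ = P * inner ℝ (y - x0) ξ := by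
    intro ξ
    obtain ⟨l1, l2, -⟩ := aux_line u y ξ (hu y hy)
    obtain ⟨b1, b2⟩ := aux_barrier x0 y ξ r γ M hφ
    have hloc : IsLocalMax (fun t : ℝ => u (y + t • ξ)
        - M * (r ^ 2 - ‖y + t • ξ - x0‖ ^ 2) ^ (-γ)) 0 := by
      filter_upwards [b1] with t ht
      have hpos := ht.1
      have hmem : y + t • ξ ∈ closedBall x0 r := by
        rw [mem_closedBall, dist_eq_norm]
        nlinarith [norm_nonneg (y + t • ξ - x0)]
      have hle : u (y + t • ξ) * (r ^ 2 - ‖y + t • ξ - x0‖ ^ 2) ^ γ ≤ M := hmax hmem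
      have : u (y + t • ξ) ≤ M * (r ^ 2 - ‖y + t • ξ - x0‖ ^ 2) ^ (-γ) := by
        rw [Real.rpow_neg hpos.le, ← div_eq_mul_inv, le_div_iff₀ (by positivity)]
        exact hle
      simp only [zero_smul, add_zero, ← hφd, ← huy]
      linarith
    have hd : ∀ᶠ t in nhds (0:ℝ), HasDerivAt (fun t : ℝ => u (y + t • ξ)
        - M * (r ^ 2 - ‖y + t • ξ - x0‖ ^ 2) ^ (-γ))
        (fderiv ℝ u (y + t • ξ) ξ - 2 * γ * M * (r ^ 2 - ‖y + t • ξ - x0‖ ^ 2) ^ (-γ - 1) *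
        (inner ℝ (y - x0) ξ + t * ‖ξ‖ ^ 2)) t := by
      filter_upwards [l1, b1] with t h1 h2 using h1.sub h2.2
    constructor
    · have := aux_second_le _ _ _ hd (l2.sub b2) hloc
      linarith
    · have := hloc.hasDerivAt_eq_zero hd.self_of_nhds
      simp only [zero_smul, add_zero, zero_mul, ← hφd, ← hP] at this
      linarith
  have hsum := aux_sum_ineq (a y) (b y) (c y) K lam Lam hlam (hs y) (hb y) (hA y)
    (fun i j => pd2 u i j y) (fun i => pd u i y) (y - x0) S P hSpos.le hPpos.le
    (fun ξ => (hkey ξ).1) (fun i => by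
      rw [pd, (hkey _).2]
      simp [EuclideanSpace.inner_single_right])
  have hLy := hL y hy
  rw [max_eq_left huypos.le, Lop] at hLy
  have hcu : 0 ≤ c y * u y := mul_nonneg (hc y).1 huypos.le
  have hD : 0 < D := by linarith
  apply aux_final p hp _ r M φ (u y) (u x0) (by positivity) hr hM hφ huy _ hu0 h0
  set T := M * φ ^ (-γ - 2) with hT
  have hTpos : 0 < T := by positivity
  have hPT : P = 2 * γ * T * φ := by
    have : φ ^ (-γ - 1) = φ ^ (-γ - 2) * φ := by
      rw [← Real.rpow_add_one hφ.ne']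
      congr 1
      ring
    rw [hP, hT, this]
    ring
  have hz2 : ‖y - x0‖ ^ 2 ≤ r ^ 2 := by linarith
  have hφr : φ ≤ r ^ 2 := by rw [hφd]; linarith [sq_nonneg ‖y - x0‖]
  have hPr : P ≤ 2 * γ * T * r ^ 2 := by rw [hPT]; gcongr
  have hzD : ‖y - x0‖ ≤ D := by linarith
  calc u y ^ p ≤ S * (Lam * ‖y - x0‖ ^ 2) + P * (n * Lam) + P * (√K * ‖y - x0‖) := by linarith
    _ ≤ S * (Lam * r ^ 2) + (2 * γ * T * r ^ 2) * (n * Lam)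
        + (2 * γ * T * r ^ 2) * (√K * D) := by gcongr
    _ = _ := by rw [hS]; ring

/-- Remark 4.4 of the paper. There is a constant `N₂ > 0`
depending only on `n, λ, Λ, K, p` and `diam Ω` (formalized as a positive function
of the diameter) such that every `C²(Ω)` solution of `Lu = u₊^p` in `Ω` (with no
boundary condition imposed) satisfies `u₊^p ≤ N₂ d^{-β}` in all of `Ω`, where
`β = 2p/(p-1)`. -/
theorem keller_osserman_upper_bound {n : ℕ} (hn : 2 ≤ n)
    (K lam Lam : ℝ) (hK : 0 < K) (hlam : 0 < lam) (hlL : lam ≤ Lam)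
    (p : ℝ) (hp : 1 < p) :
    ∃ N₂ : ℝ → ℝ, (∀ D : ℝ, 0 < N₂ D) ∧
      ∀ (Ω : Set (EuclideanSpace ℝ (Fin n))),
        IsOpen Ω → IsConnected Ω → IsBounded Ω →
      ∀ (a : EuclideanSpace ℝ (Fin n) → Fin n → Fin n → ℝ)
        (b : EuclideanSpace ℝ (Fin n) → Fin n → ℝ)
        (c : EuclideanSpace ℝ (Fin n) → ℝ), CoeffsOK a b c K lam Lam →
      ∀ u : EuclideanSpace ℝ (Fin n) → ℝ, ContDiffOn ℝ 2 u Ω →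
        (∀ x ∈ Ω, Lop a b c u x = (max (u x) 0) ^ p) →
        ∀ x ∈ Ω, (max (u x) 0) ^ p ≤ N₂ (diam Ω) / infDist x (frontier Ω) ^ (2 * p / (p - 1)) := by
  have hp1 : 0 < p - 1 := by linarith
  have hLam : 0 < Lam := by linarith
  have hn0 : (0:ℝ) < n := by exact_mod_cast (by omega : 0 < n)
  refine ⟨fun D => (4 * (2 / (p - 1)) * (2 / (p - 1) + 1) * Lam + 2 * (2 / (p - 1)) * (n * Lam)
      + 2 * (2 / (p - 1)) * (√K * |D|)) ^ (p / (p - 1)) * 2 ^ (2 * p / (p - 1)), ?_, ?_⟩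
  · intro D
    positivity
  intro Ω hΩ hconn hbd a b c hco u hu hL x hx
  have hR0 : 0 ≤ infDist x (frontier Ω) := infDist_nonneg
  rcases le_or_gt (u x) 0 with hux | hux
  · rw [max_eq_right hux, Real.zero_rpow (by linarith)]
    positivity
  have : Nonempty (Fin n) := ⟨⟨0, by omega⟩⟩
  have hne : Ω ≠ univ := by
    intro h
    rw [h] at hbd
    exact NormedSpace.unbounded_univ ℝ (EuclideanSpace ℝ (Fin n)) hbd
  have hfr : (frontier Ω).Nonempty := nonempty_frontier_iff.2 ⟨⟨x, hx⟩, hne⟩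
  have hxf : x ∉ frontier Ω := by
    rw [hΩ.frontier_eq]
    exact fun h => h.2 hx
  have hR : 0 < infDist x (frontier Ω) :=
    (isClosed_frontier.notMem_iff_infDist_pos hfr).1 hxf
  set R := infDist x (frontier Ω) with hRd
  have hRD : R ≤ diam Ω := by
    obtain ⟨z, hz⟩ := hfr
    refine (infDist_le_dist_of_mem hz).trans ?_
    rw [← diam_closure]
    exact dist_le_diam_of_mem hbd.closure (subset_closure hx) (frontier_subset_closure hz)
  have hball : closedBall x (R / 2) ⊆ Ω := by
    have hdis : Disjoint (closedBall x (R / 2)) (frontier Ω) := by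
      rw [Set.disjoint_left]
      intro z hz hzf
      have h1 : R ≤ dist x z := infDist_le_dist_of_mem hzf
      rw [mem_closedBall, dist_comm] at hz
      linarith
    have hpre : IsPreconnected (closedBall x (R / 2)) :=
      (convex_closedBall x (R / 2)).isPreconnected
    refine hpre.subset_left_of_subset_union hΩ (isClosed_closure (s := Ω)).isOpen_compl ?_ ?_
      ⟨x, mem_closedBall_self (by positivity), hx⟩
    · exact Set.disjoint_left.2 fun z hz hz2 => hz2 (subset_closure hz)
    · intro z hz
      by_cases hzc : z ∈ closure Ω
      · left
        by_contra hzΩ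
        refine Set.disjoint_left.1 hdis hz ?_
        rw [hΩ.frontier_eq]
        exact ⟨hzc, hzΩ⟩
      · exact Or.inr hzc
  have hkey := aux_key hn K lam Lam hK hlam hlL p hp x (R / 2) |diam Ω| (by positivity)
    (by linarith [le_abs_self (diam Ω)]) a b c hco u
    (fun z hz => hu.contDiffAt (hΩ.mem_nhds (hball hz))) (fun z hz => hL z (hball hz)) hux
  rw [max_eq_left hux.le]
  refine hkey.trans_eq ?_
  rw [Real.div_rpow hR.le (by norm_num)]
  field_simp
end

section
/- Sharp lower blow-up rate under the uniform exterior ball condition: Let p > 1 and β := 2p/(p−1). Assume Ω ⊂ ℝⁿ (n ≥ 2) is a bounded domain satisfying the uniform exterior ball condition with constants δ₁ ∈ (0,1) and r₁ > 0, and set ρ := min(r₁, 1/2). Then there exists a constant N > 0, depending only on n, λ, Λ, K, p, δ₁ and r₁, such that every u ∈ C²(Ω) satisfying Lu(x) = (u(x))₊^p for all x ∈ Ω and u(x) → +∞ as d(x) → 0 obeys (u(x))₊^p ≥ N d(x)^{−β} for all x ∈ Δ_ρ := {x ∈ Ω : d(x) < ρ}. -/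
open Metric Set Filter Real Bornology

lemma pd2_eq_hess {n : ℕ} {u : EuclideanSpace ℝ (Fin n) → ℝ} {x : EuclideanSpace ℝ (Fin n)}
    (hu : ContDiffAt ℝ 2 u x) (i j : Fin n) :
    pd2 u i j x = fderiv ℝ (fderiv ℝ u) x (EuclideanSpace.single i 1)
      (EuclideanSpace.single j 1) := by
  have h1 : DifferentiableAt ℝ (fderiv ℝ u) x :=
    (hu.fderiv_right (m := 1) (by norm_num)).differentiableAt (by norm_num)
  unfold pd2
  rw [fderiv_clm_apply h1 (differentiableAt_const _)]
  simp

lemma hess_nonpos {n : ℕ} {h : EuclideanSpace ℝ (Fin n) → ℝ} {x : EuclideanSpace ℝ (Fin n)}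
    (hh : ContDiffAt ℝ 2 h x) (hm : IsLocalMax h x) (ξ : EuclideanSpace ℝ (Fin n)) :
    fderiv ℝ (fderiv ℝ h) x ξ ξ ≤ 0 := by
  have h1 : DifferentiableAt ℝ (fderiv ℝ h) x :=
    (hh.fderiv_right (m := 1) (by norm_num)).differentiableAt (by norm_num)
  have hline : ∀ t : ℝ, HasDerivAt (fun t : ℝ => x + t • ξ) ξ t := by
    intro t
    simpa using ((hasDerivAt_id t).smul_const ξ).const_add x
  have hx0 : x + (0 : ℝ) • ξ = x := by simp
  have hcont : Filter.Tendsto (fun t : ℝ => x + t • ξ) (nhds 0) (nhds x) := by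
    have := (hline 0).continuousAt
    unfold ContinuousAt at this
    simpa only [hx0] using this
  set g : ℝ → ℝ := fun t => h (x + t • ξ) with hg
  have hev : ∀ᶠ y in nhds x, DifferentiableAt ℝ h y :=
    (hh.eventually (by simp)).mono fun y hy => hy.differentiableAt (by norm_num)
  have hd1 : deriv g =ᶠ[nhds 0] fun t => fderiv ℝ h (x + t • ξ) ξ := by
    filter_upwards [hcont.eventually hev] with t ht
    exact (ht.hasFDerivAt.comp_hasDerivAt t (hline t)).deriv
  have hd2 : deriv (deriv g) 0 = fderiv ℝ (fderiv ℝ h) x ξ ξ := by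
    rw [hd1.deriv_eq]
    have h2 : HasFDerivAt (fderiv ℝ h) (fderiv ℝ (fderiv ℝ h) x) (x + (0 : ℝ) • ξ) := by
      rw [hx0]; exact h1.hasFDerivAt
    have h3 : HasFDerivAt (fun y => fderiv ℝ h y ξ) ((fderiv ℝ (fderiv ℝ h) x).flip ξ)
        (x + (0 : ℝ) • ξ) := by
      simpa using h2.clm_apply (hasFDerivAt_const ξ (x + (0 : ℝ) • ξ))
    exact (h3.comp_hasDerivAt (0 : ℝ) (hline 0)).deriv
  have hmg : IsLocalMax g 0 := by
    have : ∀ᶠ t in nhds (0 : ℝ), h (x + t • ξ) ≤ h x := hcont.eventually hm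
    filter_upwards [this] with t ht
    simpa [hg] using ht
  by_contra hcon
  push Not at hcon
  rw [← hd2] at hcon
  have hgc : ContinuousAt g 0 := by
    have := hh.continuousAt
    rw [← hx0] at this
    exact ContinuousAt.comp (f := fun t : ℝ => x + t • ξ) this (hline 0).continuousAt
  have hmin := isLocalMin_of_deriv_deriv_pos hcon hmg.deriv_eq_zero hgc
  have hconst : g =ᶠ[nhds 0] fun _ => g 0 := by
    filter_upwards [hmin, hmg] with t h1 h2
    exact le_antisymm h2 h1
  have hz : deriv (deriv g) 0 = 0 := by
    have := hconst.deriv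
    rw [this.deriv_eq]
    simp
  linarith

lemma sum_psd_hess_nonpos {n : ℕ} (A : Fin n → Fin n → ℝ) (hsym : ∀ i j, A i j = A j i)
    (hpos : ∀ ξ : EuclideanSpace ℝ (Fin n), 0 ≤ ∑ i, ∑ j, A i j * ξ i * ξ j)
    (H : EuclideanSpace ℝ (Fin n) →L[ℝ] EuclideanSpace ℝ (Fin n) →L[ℝ] ℝ)
    (hH : ∀ ξ, H ξ ξ ≤ 0) :
    ∑ i, ∑ j, A i j * H (EuclideanSpace.single i 1) (EuclideanSpace.single j 1) ≤ 0 := by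
  have hP : (Matrix.of A).PosSemidef := by
    refine Matrix.PosSemidef.of_dotProduct_mulVec_nonneg ?_ ?_
    · ext i j
      simp [hsym j i]
    · intro x
      have := hpos (WithLp.toLp 2 x)
      simp only [dotProduct, Matrix.mulVec, Finset.mul_sum, Matrix.of_apply, star_trivial]
      refine this.trans_eq ?_
      refine Finset.sum_congr rfl fun i _ => Finset.sum_congr rfl fun j _ => ?_
      ring
  obtain ⟨B, hB⟩ : ∃ B : Matrix (Fin n) (Fin n) ℝ, Matrix.of A = B.conjTranspose * B := by
    open scoped MatrixOrder in
    exact CStarAlgebra.nonneg_iff_eq_star_mul_self.mp hP.nonneg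
  have hA : ∀ i j, A i j = ∑ k, B k i * B k j := by
    intro i j
    have := congrFun (congrFun hB i) j
    simpa [Matrix.mul_apply] using this
  have hexp : ∀ k, H (∑ i, B k i • EuclideanSpace.single i (1 : ℝ))
      (∑ j, B k j • EuclideanSpace.single j (1 : ℝ)) =
      ∑ i, ∑ j, B k i * B k j * H (EuclideanSpace.single i 1) (EuclideanSpace.single j 1) := by
    intro k
    simp only [map_sum, map_smul, sum_apply, smul_apply,
      smul_eq_mul, Finset.mul_sum]
    rw [Finset.sum_comm]
    refine Finset.sum_congr rfl fun i _ => Finset.sum_congr rfl fun j _ => ?_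
    ring
  have : ∑ i, ∑ j, A i j * H (EuclideanSpace.single i 1) (EuclideanSpace.single j 1) =
      ∑ k, H (∑ i, B k i • EuclideanSpace.single i (1 : ℝ))
      (∑ j, B k j • EuclideanSpace.single j (1 : ℝ)) := by
    simp only [hexp, hA, Finset.sum_mul]
    rw [Finset.sum_comm]
    conv_rhs => rw [Finset.sum_comm]; enter [2, i]; rw [Finset.sum_comm]
    rw [Finset.sum_comm]
  rw [this]
  exact Finset.sum_nonpos fun k _ => hH _

lemma comparison {n : ℕ} {K lam Lam p : ℝ} (hp : 1 < p)
    {Ω : Set (EuclideanSpace ℝ (Fin n))} (hΩ : IsOpen Ω) (hb : IsBounded Ω)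
    {a : EuclideanSpace ℝ (Fin n) → Fin n → Fin n → ℝ}
    {b : EuclideanSpace ℝ (Fin n) → Fin n → ℝ}
    {c : EuclideanSpace ℝ (Fin n) → ℝ} (hco : CoeffsOK a b c K lam Lam)
    {u v : EuclideanSpace ℝ (Fin n) → ℝ} (hu : ContDiffOn ℝ 2 u Ω)
    (hLu : ∀ x ∈ Ω, Lop a b c u x = (max (u x) 0) ^ p) (hbl : BlowsUp Ω u)
    (hv : ∀ x ∈ Ω, ContDiffAt ℝ 2 v x) (M : ℝ) (hvM : ∀ x ∈ Ω, v x ≤ M)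
    (hLv : ∀ x ∈ Ω, u x < v x → (max (v x) 0) ^ p < Lop a b c v x) :
    ∀ x ∈ Ω, v x ≤ u x := by
  intro x₀ hx₀
  by_contra hcon
  push Not at hcon
  obtain ⟨δ, hδ, hδM⟩ := hbl M
  have hu' : ∀ x ∈ Ω, ContDiffAt ℝ 2 u x := fun x hx => hu.contDiffAt (hΩ.mem_nhds hx)
  set C := closure Ω ∩ {x | δ ≤ infDist x (frontier Ω)} with hC
  have hCc : IsCompact C :=
    hb.isCompact_closure.inter_right
      (isClosed_le continuous_const (continuous_infDist_pt _))
  have hCΩ : C ⊆ Ω := by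
    rintro x ⟨hx1, hx2⟩
    have hx2 : δ ≤ infDist x (frontier Ω) := hx2
    by_contra hx
    have : x ∈ frontier Ω := by
      rw [hΩ.frontier_eq]; exact ⟨hx1, hx⟩
    rw [infDist_zero_of_mem this] at hx2
    linarith
  have hout : ∀ x ∈ Ω, x ∉ C → v x - u x ≤ 0 := by
    intro x hx hxC
    have : infDist x (frontier Ω) < δ := by
      by_contra h
      exact hxC ⟨subset_closure hx, not_lt.mp h⟩
    linarith [hδM x hx this, hvM x hx]
  have hx₀C : x₀ ∈ C := by
    by_contra h
    linarith [hout x₀ hx₀ h]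
  obtain ⟨z, hzC, hz⟩ := hCc.exists_isMaxOn (f := fun x => v x - u x) ⟨x₀, hx₀C⟩
    (fun x hx => ((hv x (hCΩ hx)).continuousAt.sub
      (hu' x (hCΩ hx)).continuousAt).continuousWithinAt)
  have hzΩ := hCΩ hzC
  have hzx : v x₀ - u x₀ ≤ v z - u z := hz hx₀C
  have hmax : IsLocalMax (v - u) z := by
    filter_upwards [hΩ.mem_nhds hzΩ] with y hy
    by_cases hyC : y ∈ C
    · exact hz hyC
    · have := hout y hy hyC
      simp only [Pi.sub_apply]
      linarith
  have hvz := hv z hzΩ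
  have huz := hu' z hzΩ
  have hh : ContDiffAt ℝ 2 (v - u) z := hvz.sub huz
  have hev : ∀ {f : EuclideanSpace ℝ (Fin n) → ℝ}, ContDiffAt ℝ 2 f z →
      ∀ᶠ y in nhds z, DifferentiableAt ℝ f y := fun hf =>
    (hf.eventually (by simp)).mono fun y hy => hy.differentiableAt (by norm_num)
  have hdd : ∀ {f : EuclideanSpace ℝ (Fin n) → ℝ}, ContDiffAt ℝ 2 f z →
      DifferentiableAt ℝ (fderiv ℝ f) z := fun hf =>
    (hf.fderiv_right (m := 1) (by norm_num)).differentiableAt (by norm_num)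
  have hf1 : fderiv ℝ (v - u) =ᶠ[nhds z] fderiv ℝ v - fderiv ℝ u := by
    filter_upwards [hev hvz, hev huz] with y h1 h2
    exact fderiv_sub h1 h2
  have hf2 : fderiv ℝ (fderiv ℝ (v - u)) z =
      fderiv ℝ (fderiv ℝ v) z - fderiv ℝ (fderiv ℝ u) z := by
    rw [hf1.fderiv_eq]
    exact fderiv_sub (hdd hvz) (hdd huz)
  have hgrad : fderiv ℝ v z = fderiv ℝ u z := by
    have := hmax.fderiv_eq_zero
    rw [hf1.self_of_nhds] at this
    exact sub_eq_zero.mp this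
  obtain ⟨-, -, -, hsym, -, hc, -, hlam, -, hell⟩ := hco
  have hsum := sum_psd_hess_nonpos (a z) (hsym z)
    (fun ξ => le_trans (by positivity) (hell z ξ).1) _ (hess_nonpos hh hmax)
  have hsum2 : ∑ i, ∑ j, a z i j * pd2 v i j z ≤ ∑ i, ∑ j, a z i j * pd2 u i j z := by
    rw [← sub_nonpos, ← Finset.sum_sub_distrib]
    refine le_trans (le_of_eq ?_) hsum
    refine Finset.sum_congr rfl fun i _ => ?_
    rw [← Finset.sum_sub_distrib]
    refine Finset.sum_congr rfl fun j _ => ?_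
    rw [pd2_eq_hess hvz, pd2_eq_hess huz, hf2]
    simp only [sub_apply]
    ring
  have hlt : u z < v z := by linarith
  have h1 := hLv z hzΩ hlt
  have h2 := hLu z hzΩ
  have h3 : (max (u z) 0) ^ p ≤ (max (v z) 0) ^ p :=
    Real.rpow_le_rpow (le_max_right _ _) (max_le_max hlt.le le_rfl) (by linarith)
  have h4 : c z * u z ≤ c z * v z := mul_le_mul_of_nonneg_left hlt.le (hc z).1
  have h5 : ∑ i, b z i * pd v i z = ∑ i, b z i * pd u i z := by
    simp only [pd, hgrad]
  unfold Lop at h1 h2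
  linarith

lemma radial_hasFDerivAt {n : ℕ} (y x : EuclideanSpace ℝ (Fin n)) (hxy : x ≠ y) (q : ℝ) :
    HasFDerivAt (fun z : EuclideanSpace ℝ (Fin n) => (‖z - y‖ ^ 2) ^ q)
      ((q * (‖x - y‖ ^ 2) ^ (q - 1)) • ((2 : ℝ) • innerSL ℝ (x - y))) x := by
  have h0 : ‖x - y‖ ^ 2 ≠ 0 := by
    have := norm_pos_iff.mpr (sub_ne_zero.mpr hxy)
    positivity
  have h1 : HasFDerivAt (fun z : EuclideanSpace ℝ (Fin n) => ‖z - y‖ ^ 2)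
      ((2 : ℝ) • innerSL ℝ (x - y)) x := by
    have h2 := (hasStrictFDerivAt_norm_sq (x - y)).hasFDerivAt
    have h3 := h2.comp x ((hasFDerivAt_id x).sub_const y)
    refine h3.congr_fderiv ?_
    ext w
    simp
  exact h1.rpow_const (Or.inl h0)

lemma radial_contDiffAt {n : ℕ} (y x : EuclideanSpace ℝ (Fin n)) (hxy : x ≠ y) (q A B : ℝ) :
    ContDiffAt ℝ 2 (fun z : EuclideanSpace ℝ (Fin n) => A * (‖z - y‖ ^ 2) ^ q - B) x := by
  have h0 : ‖x - y‖ ^ 2 ≠ 0 := by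
    have := norm_pos_iff.mpr (sub_ne_zero.mpr hxy)
    positivity
  have h1 : ContDiffAt ℝ 2 (fun z : EuclideanSpace ℝ (Fin n) => ‖z - y‖ ^ 2) x :=
    ((contDiff_id.sub contDiff_const).norm_sq ℝ).contDiffAt
  exact (contDiffAt_const.mul (h1.rpow_const_of_ne h0)).sub contDiffAt_const

lemma radial_fderiv {n : ℕ} (y x : EuclideanSpace ℝ (Fin n)) (hxy : x ≠ y) (q A B : ℝ)
    (i : Fin n) :
    fderiv ℝ (fun z : EuclideanSpace ℝ (Fin n) => A * (‖z - y‖ ^ 2) ^ q - B) x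
      (EuclideanSpace.single i 1) = 2 * q * A * (‖x - y‖ ^ 2) ^ (q - 1) * (x i - y i) := by
  have h := ((radial_hasFDerivAt y x hxy q).const_mul A).sub_const B
  rw [h.fderiv]
  simp [EuclideanSpace.inner_single_right]
  ring

lemma radial_pd2 {n : ℕ} (y x : EuclideanSpace ℝ (Fin n)) (hxy : x ≠ y) (q A B : ℝ)
    (i j : Fin n) :
    pd2 (fun z : EuclideanSpace ℝ (Fin n) => A * (‖z - y‖ ^ 2) ^ q - B) i j x =
      4 * q * (q - 1) * A * (‖x - y‖ ^ 2) ^ (q - 2) * ((x i - y i) * (x j - y j)) +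
      2 * q * A * (‖x - y‖ ^ 2) ^ (q - 1) * (if i = j then 1 else 0) := by
  unfold pd2
  have hev : (fun z => fderiv ℝ (fun z : EuclideanSpace ℝ (Fin n) =>
      A * (‖z - y‖ ^ 2) ^ q - B) z (EuclideanSpace.single j 1)) =ᶠ[nhds x]
      fun z => 2 * q * A * (‖z - y‖ ^ 2) ^ (q - 1) * (z j - y j) := by
    filter_upwards [isOpen_ne.mem_nhds hxy] with z hz
    exact radial_fderiv y z hz q A B j
  rw [hev.fderiv_eq]
  have h1 := (radial_hasFDerivAt y x hxy (q - 1)).const_mul (2 * q * A)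
  have h2 : HasFDerivAt (fun z : EuclideanSpace ℝ (Fin n) => z j - y j)
      (EuclideanSpace.proj j : EuclideanSpace ℝ (Fin n) →L[ℝ] ℝ) x :=
    (EuclideanSpace.proj j : EuclideanSpace ℝ (Fin n) →L[ℝ] ℝ).hasFDerivAt.sub_const (y j)
  rw [(h1.fun_mul h2).fderiv]
  have e : q - 1 - 1 = q - 2 := by ring
  simp only [add_apply, smul_apply, smul_eq_mul, e, innerSL_apply_apply,
    EuclideanSpace.inner_single_right]
  by_cases hij : i = j
  · subst hij
    simp
    ring
  · have hji : ¬ j = i := fun h => hij h.symm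
    simp [hij, hji]
    ring

/-- The principal plus drift part on radial powers, lower bound. -/
lemma radial_Lop {n : ℕ} {K lam Lam : ℝ}
    {a : EuclideanSpace ℝ (Fin n) → Fin n → Fin n → ℝ}
    {b : EuclideanSpace ℝ (Fin n) → Fin n → ℝ}
    {c : EuclideanSpace ℝ (Fin n) → ℝ} (hco : CoeffsOK a b c K lam Lam)
    (y x : EuclideanSpace ℝ (Fin n)) (hxy : x ≠ y) (m A B S θ : ℝ) (hm : 1 ≤ m) (hA : 0 < A)
    (hS : ‖x - y‖ ^ 2 ≤ S) (hθ : 0 ≤ θ)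
    (hmθ : n * Lam + (K + S) / 2 + θ ≤ 2 * (m + 1) * lam) :
    2 * θ * A * (‖x - y‖ ^ 2) ^ (-m - 1) - c x * (A * (‖x - y‖ ^ 2) ^ (-m) - B) ≤
    Lop a b c (fun z : EuclideanSpace ℝ (Fin n) => A * (‖z - y‖ ^ 2) ^ (-m) - B) x := by
  obtain ⟨-, -, -, -, hb, -, -, hlam, -, hell⟩ := hco
  unfold Lop
  have hs : 0 < ‖x - y‖ ^ 2 := by
    have := norm_pos_iff.mpr (sub_ne_zero.mpr hxy)
    positivity
  have hsn : ‖x - y‖ ^ 2 = ∑ i, (x i - y i) ^ 2 := by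
    rw [EuclideanSpace.norm_sq_eq]; simp
  have hE := (hell x (x - y)).1
  set s := ‖x - y‖ ^ 2 with hsdef
  set T := ∑ i, a x i i with hT
  set Q := ∑ i, ∑ j, a x i j * (x - y) i * (x - y) j with hQ
  set D := ∑ i, b x i * (x i - y i) with hD
  have hTle : T ≤ n * Lam := by
    have : ∀ i ∈ Finset.univ, a x i i ≤ Lam := by
      intro i _
      have h := (hell x (EuclideanSpace.single i 1)).2
      simpa [Finset.sum_ite_eq, Pi.single_apply] using h
    simpa using Finset.sum_le_sum this
  have hDle : D ≤ (K + s) / 2 := by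
    have h1 : D ≤ ∑ i, ((b x i) ^ 2 + (x i - y i) ^ 2) / 2 := by
      refine Finset.sum_le_sum fun i _ => ?_
      nlinarith [sq_nonneg (b x i - (x i - y i))]
    rw [← Finset.sum_div, Finset.sum_add_distrib, ← hsn] at h1
    linarith [hb x]
  have hpow : s ^ (-m - 1) = s ^ (-m - 2) * s := by
    rw [← Real.rpow_add_one hs.ne']; congr 1; ring
  have e1 : ∑ i, ∑ j, a x i j * pd2 (fun z : EuclideanSpace ℝ (Fin n) =>
      A * (‖z - y‖ ^ 2) ^ (-m) - B) i j x =
      4 * m * (m + 1) * A * s ^ (-m - 2) * Q - 2 * m * A * s ^ (-m - 1) * T := by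
    have : ∀ i j, a x i j * pd2 (fun z : EuclideanSpace ℝ (Fin n) =>
      A * (‖z - y‖ ^ 2) ^ (-m) - B) i j x =
      4 * m * (m + 1) * A * s ^ (-m - 2) * (a x i j * (x - y) i * (x - y) j) -
      2 * m * A * s ^ (-m - 1) * (if i = j then a x i j else 0) := by
      intro i j
      rw [radial_pd2 y x hxy]
      simp only [PiLp.sub_apply]
      split_ifs <;> ring
    simp only [this, Finset.sum_sub_distrib, ← Finset.mul_sum]
    simp [hQ, hT]
  have e2 : ∑ i, b x i * pd (fun z : EuclideanSpace ℝ (Fin n) =>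
      A * (‖z - y‖ ^ 2) ^ (-m) - B) i x = - 2 * m * A * s ^ (-m - 1) * D := by
    rw [hD, Finset.mul_sum]
    refine Finset.sum_congr rfl fun i _ => ?_
    unfold pd
    rw [radial_fderiv y x hxy]
    ring
  rw [e1, e2]
  have hP : 0 < s ^ (-m - 2) := Real.rpow_pos_of_pos hs _
  have k1 : 4 * m * (m + 1) * A * s ^ (-m - 2) * (lam * s) ≤
      4 * m * (m + 1) * A * s ^ (-m - 2) * Q :=
    mul_le_mul_of_nonneg_left hE (by positivity)
  have k2 : 0 ≤ 2 * m * A * (s ^ (-m - 2) * s) *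
      (2 * (m + 1) * lam - T - D - θ) :=
    mul_nonneg (by positivity) (by linarith)
  have k3 : 0 ≤ 2 * A * (s ^ (-m - 2) * s) * θ * (m - 1) :=
    mul_nonneg (by positivity) (by linarith)
  rw [hpow]
  nlinarith [k1, k2, k3]

lemma solution_nonneg {n : ℕ} {K lam Lam p : ℝ} (hp : 1 < p)
    {Ω : Set (EuclideanSpace ℝ (Fin n))} (hΩ : IsOpen Ω) (hb : IsBounded Ω)
    {a : EuclideanSpace ℝ (Fin n) → Fin n → Fin n → ℝ}
    {b : EuclideanSpace ℝ (Fin n) → Fin n → ℝ}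
    {c : EuclideanSpace ℝ (Fin n) → ℝ} (hco : CoeffsOK a b c K lam Lam)
    {u : EuclideanSpace ℝ (Fin n) → ℝ} (hu : ContDiffOn ℝ 2 u Ω)
    (hLu : ∀ x ∈ Ω, Lop a b c u x = (max (u x) 0) ^ p) (hbl : BlowsUp Ω u)
    (y : EuclideanSpace ℝ (Fin n)) (σ : ℝ) (hσ : 0 < σ) (hy : ∀ x ∈ Ω, σ ≤ ‖x - y‖ ^ 2) :
    ∀ x ∈ Ω, 0 ≤ u x := by
  intro x₀ hx₀
  by_contra hneg
  push Not at hneg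
  have hc := hco.2.2.2.2.2.1
  have hlam : 0 < lam := hco.2.2.2.2.2.2.2.1
  have hne : ∀ x ∈ Ω, x ≠ y := by
    rintro x hx rfl
    have := hy x hx
    simp at this
    linarith
  obtain ⟨R, hR⟩ := hb.subset_closedBall y
  have hS : ∀ x ∈ Ω, ‖x - y‖ ^ 2 ≤ R ^ 2 := by
    intro x hx
    have h := hR hx
    rw [mem_closedBall, dist_eq_norm] at h
    exact pow_le_pow_left₀ (norm_nonneg _) h 2
  set G := n * Lam + (K + R ^ 2) / 2 + 1 with hG
  set m := 1 + |G| / (2 * lam) with hmdef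
  have hm : 1 ≤ m := by
    have : 0 ≤ |G| / (2 * lam) := by positivity
    linarith
  have hmG : n * Lam + (K + R ^ 2) / 2 + 1 ≤ 2 * (m + 1) * lam := by
    have h1 : 2 * lam * (|G| / (2 * lam)) = |G| := by field_simp
    have h2 := le_abs_self G
    have h3 : 2 * (m + 1) * lam = 4 * lam + 2 * lam * (|G| / (2 * lam)) := by
      rw [hmdef]; ring
    rw [h3, h1]
    linarith
  set B₀ := σ ^ (-m) with hB₀
  have hB₀pos : 0 < B₀ := Real.rpow_pos_of_pos hσ _
  set ε := -u x₀ / (2 * (B₀ + 1)) with hε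
  have hεpos : 0 < ε := div_pos (by linarith) (by positivity)
  have hle : ∀ x ∈ Ω, ε * (‖x - y‖ ^ 2) ^ (-m) - ε * B₀ ≤ 0 := by
    intro x hx
    have : (‖x - y‖ ^ 2) ^ (-m) ≤ B₀ :=
      Real.rpow_le_rpow_of_nonpos hσ (hy x hx) (by linarith)
    nlinarith
  have key := comparison hp hΩ hb hco hu hLu hbl
    (v := fun z => ε * (‖z - y‖ ^ 2) ^ (-m) - ε * B₀)
    (fun x hx => radial_contDiffAt y x (hne x hx) _ _ _) 0 hle
    (by
      intro x hx _
      have h1 := radial_Lop hco y x (hne x hx) m ε (ε * B₀) (R ^ 2) 1 hm hεpos (hS x hx)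
        zero_le_one hmG
      refine lt_of_lt_of_le ?_ h1
      have h2 := hle x hx
      rw [max_eq_right h2, Real.zero_rpow (by linarith)]
      have h3 : 0 < (‖x - y‖ ^ 2) ^ (-m - 1) :=
        Real.rpow_pos_of_pos (lt_of_lt_of_le hσ (hy x hx)) _
      have h4 := mul_nonneg (hc x).1 (neg_nonneg.mpr h2)
      have h5 : 0 < 2 * 1 * ε * (‖x - y‖ ^ 2) ^ (-m - 1) := by positivity
      linarith)
    x₀ hx₀
  have h3 : 0 < (‖x₀ - y‖ ^ 2) ^ (-m) :=
    Real.rpow_pos_of_pos (lt_of_lt_of_le hσ (hy x₀ hx₀)) _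
  have h4 : 0 < ε * (‖x₀ - y‖ ^ 2) ^ (-m) := by positivity
  have h5 : ε * (2 * (B₀ + 1)) = -u x₀ := by
    rw [hε]; field_simp
  nlinarith

/-- Lower bound with the explicit barrier. -/
lemma barrier_bound {n : ℕ} {K lam Lam p : ℝ} (hp : 1 < p)
    {Ω : Set (EuclideanSpace ℝ (Fin n))} (hΩ : IsOpen Ω) (hb : IsBounded Ω)
    {a : EuclideanSpace ℝ (Fin n) → Fin n → Fin n → ℝ}
    {b : EuclideanSpace ℝ (Fin n) → Fin n → ℝ}
    {c : EuclideanSpace ℝ (Fin n) → ℝ} (hco : CoeffsOK a b c K lam Lam)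
    {u : EuclideanSpace ℝ (Fin n) → ℝ} (hu : ContDiffOn ℝ 2 u Ω)
    (hLu : ∀ x ∈ Ω, Lop a b c u x = (max (u x) 0) ^ p) (hbl : BlowsUp Ω u)
    (y : EuclideanSpace ℝ (Fin n)) (σ : ℝ) (hσ : 0 < σ) (hy : ∀ x ∈ Ω, σ ≤ ‖x - y‖ ^ 2)
    (m : ℝ) (hm : 1 ≤ m) (hmp : 1 ≤ m * (p - 1))
    (hmG : n * Lam + (K + 4) / 2 + (2 * K + 1) ≤ 2 * (m + 1) * lam) :
    ∀ x ∈ Ω, σ ^ (m - 1 / (p - 1)) * (‖x - y‖ ^ 2) ^ (-m) -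
      σ ^ (m - 1 / (p - 1)) * 4 ^ (-m) ≤ u x := by
  have hc := hco.2.2.2.2.2.1
  have hK : 0 < K := hco.2.2.2.2.2.2.1
  have hu0 := solution_nonneg hp hΩ hb hco hu hLu hbl y σ hσ hy
  have hne : ∀ x ∈ Ω, x ≠ y := by
    rintro x hx rfl
    have := hy x hx
    simp at this
    linarith
  set A := σ ^ (m - 1 / (p - 1)) with hA
  have hApos : 0 < A := Real.rpow_pos_of_pos hσ _
  have h4m : (0 : ℝ) < 4 ^ (-m) := Real.rpow_pos_of_pos (by norm_num) _
  refine comparison hp hΩ hb hco hu hLu hbl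
    (v := fun z => A * (‖z - y‖ ^ 2) ^ (-m) - A * 4 ^ (-m))
    (fun x hx => radial_contDiffAt y x (hne x hx) _ _ _) (A * σ ^ (-m)) ?_ ?_
  · intro x hx
    have : (‖x - y‖ ^ 2) ^ (-m) ≤ σ ^ (-m) :=
      Real.rpow_le_rpow_of_nonpos hσ (hy x hx) (by linarith)
    have h2 := mul_le_mul_of_nonneg_left this hApos.le
    have : 0 < A * 4 ^ (-m) := by positivity
    linarith
  · intro x hx hlt
    have hwpos := lt_of_le_of_lt (hu0 x hx) hlt
    have hspos : 0 < ‖x - y‖ ^ 2 := lt_of_lt_of_le hσ (hy x hx)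
    have hs4 : ‖x - y‖ ^ 2 ≤ 4 := by
      by_contra hcon
      push Not at hcon
      have : (‖x - y‖ ^ 2) ^ (-m) ≤ 4 ^ (-m) :=
        Real.rpow_le_rpow_of_nonpos (by norm_num) hcon.le (by linarith)
      nlinarith
    have h1 := radial_Lop hco y x (hne x hx) m A (A * 4 ^ (-m)) 4 (2 * K + 1) hm hApos hs4
      (by linarith) hmG
    refine lt_of_lt_of_le ?_ h1
    have hσs := hy x hx
    set s := ‖x - y‖ ^ 2 with hs
    have hP : 0 < s ^ (-m - 1) := Real.rpow_pos_of_pos hspos _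
    have hpow : s ^ (-m) = s ^ (-m - 1) * s := by
      rw [← Real.rpow_add_one hspos.ne']; congr 1; ring
    have hw : A * s ^ (-m) - A * 4 ^ (-m) ≤ A * s ^ (-m) := by
      have : 0 < A * 4 ^ (-m) := by positivity
      linarith
    have hcw : c x * (A * s ^ (-m) - A * 4 ^ (-m)) ≤ K * (A * (s ^ (-m - 1) * 4)) := by
      refine mul_le_mul (hc x).2 (hw.trans ?_) hwpos.le hK.le
      rw [hpow]
      gcongr
    have hpw : (max (A * s ^ (-m) - A * 4 ^ (-m)) 0) ^ p ≤ A * s ^ (-m - 1) := by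
      rw [max_eq_left hwpos.le]
      have e1 : (A * s ^ (-m) - A * 4 ^ (-m)) ^ p ≤ (A * s ^ (-m)) ^ p :=
        Real.rpow_le_rpow hwpos.le hw (by linarith)
      refine e1.trans ?_
      have hAp : A ^ (p - 1) = σ ^ (m * (p - 1) - 1) := by
        rw [hA, ← Real.rpow_mul hσ.le]
        congr 1
        have : p - 1 ≠ 0 := by linarith
        field_simp
      have hle : A ^ (p - 1) ≤ s ^ (m * (p - 1) - 1) := by
        rw [hAp]
        exact Real.rpow_le_rpow hσ.le hσs (by linarith)
      have e2 : (A * s ^ (-m)) ^ p = A * A ^ (p - 1) * s ^ (-m * p) := by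
        rw [Real.mul_rpow hApos.le (Real.rpow_nonneg hspos.le _), ← Real.rpow_mul hspos.le]
        congr 1
        have := Real.rpow_add hApos 1 (p - 1)
        rw [Real.rpow_one] at this
        rw [← this]; congr 1; ring
      have e3 : s ^ (-m - 1) = s ^ (m * (p - 1) - 1) * s ^ (-m * p) := by
        rw [← Real.rpow_add hspos]; congr 1; ring
      rw [e2, e3, mul_assoc]
      have : 0 < s ^ (-m * p) := Real.rpow_pos_of_pos hspos _
      gcongr
    have hAP : 0 < A * s ^ (-m - 1) := by positivity
    nlinarith

/-- Lemma 4.5 of the paper. If `Ω` satisfies the uniform exterior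
ball condition with constants `δ₁ ∈ (0,1)`, `r₁ > 0`, then there is `N > 0`
depending only on `n, λ, Λ, K, p, δ₁, r₁` such that every blow-up solution of
`Lu = u₊^p` satisfies `u₊^p ≥ N d^{-β}` in `Δ_ρ`, where `ρ = min(r₁, 1/2)` and
`β = 2p/(p-1)`. -/
theorem lower_rate_exterior_ball {n : ℕ} (hn : 2 ≤ n)
    (K lam Lam : ℝ) (hK : 0 < K) (hlam : 0 < lam) (hlL : lam ≤ Lam)
    (p : ℝ) (hp : 1 < p)
    (δ₁ r₁ : ℝ) (hδ₁ : δ₁ ∈ Ioo (0 : ℝ) 1) (hr₁ : 0 < r₁) :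
    ∃ N : ℝ, 0 < N ∧
      ∀ (Ω : Set (EuclideanSpace ℝ (Fin n))),
        IsOpen Ω → IsConnected Ω → IsBounded Ω →
        (∀ x ∈ frontier Ω, ∀ r : ℝ, 0 < r → r < r₁ →
          ∃ y, ball y (δ₁ * r) ⊆ ball x r \ closure Ω) →
      ∀ (a : EuclideanSpace ℝ (Fin n) → Fin n → Fin n → ℝ)
        (b : EuclideanSpace ℝ (Fin n) → Fin n → ℝ)
        (c : EuclideanSpace ℝ (Fin n) → ℝ), CoeffsOK a b c K lam Lam →
      ∀ u : EuclideanSpace ℝ (Fin n) → ℝ, ContDiffOn ℝ 2 u Ω →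
        (∀ x ∈ Ω, Lop a b c u x = (max (u x) 0) ^ p) → BlowsUp Ω u →
        ∀ x ∈ Ω, infDist x (frontier Ω) < min r₁ (1 / 2) →
          N / infDist x (frontier Ω) ^ (2 * p / (p - 1)) ≤ (max (u x) 0) ^ p := by
  obtain ⟨hδ0, hδ1⟩ := hδ₁
  have hp1 : 0 < p - 1 := by linarith
  set G := n * Lam + (K + 4) / 2 + (2 * K + 1) with hG
  set m := 1 + 1 / (p - 1) + |G| / (2 * lam) with hmdef
  have hq : 0 < 1 / (p - 1) := by positivity
  have hGl : 0 ≤ |G| / (2 * lam) := by positivity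
  have hm : 1 ≤ m := by linarith
  have hmp : 1 ≤ m * (p - 1) := by
    have h1 : 1 / (p - 1) * (p - 1) = 1 := by field_simp
    have h2 : 1 / (p - 1) * (p - 1) ≤ m * (p - 1) :=
      mul_le_mul_of_nonneg_right (by linarith) hp1.le
    linarith
  have hmG : n * Lam + (K + 4) / 2 + (2 * K + 1) ≤ 2 * (m + 1) * lam := by
    have h1 : 2 * lam * (|G| / (2 * lam)) = |G| := by field_simp
    have h2 := le_abs_self G
    have h3 : 2 * (m + 1) * lam = (4 + 2 * (1 / (p - 1))) * lam + 2 * lam * (|G| / (2 * lam)) := by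
      rw [hmdef]; ring
    have h4 : 0 < (4 + 2 * (1 / (p - 1))) * lam := by positivity
    rw [h3, h1]
    linarith
  set C := (1 / 2) * (δ₁ ^ 2) ^ (m - 1 / (p - 1)) * (4 : ℝ) ^ (-m) with hC
  have hCpos : 0 < C := by
    have h1 : 0 < (δ₁ ^ 2) ^ (m - 1 / (p - 1)) := Real.rpow_pos_of_pos (by positivity) _
    have h2 : (0 : ℝ) < 4 ^ (-m) := Real.rpow_pos_of_pos (by norm_num) _
    positivity
  refine ⟨C ^ p, Real.rpow_pos_of_pos hCpos _, ?_⟩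
  intro Ω hΩ hconn hb hext a b c hco u hu hLu hbl x hx hd
  have hfne : (frontier Ω).Nonempty := by
    rw [nonempty_iff_ne_empty]
    intro h
    rcases frontier_eq_empty_iff.mp h with h | h
    · exact hconn.nonempty.ne_empty h
    · haveI : Nontrivial (EuclideanSpace ℝ (Fin n)) := by
        haveI : Nonempty (Fin n) := ⟨⟨0, by omega⟩⟩
        infer_instance
      rw [h] at hb
      exact NormedSpace.unbounded_univ ℝ (EuclideanSpace ℝ (Fin n)) hb
  have hdpos : 0 < infDist x (frontier Ω) := by
    rw [← isClosed_frontier.notMem_iff_infDist_pos hfne, hΩ.frontier_eq]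
    exact fun h => h.2 hx
  obtain ⟨z, hz, hzd⟩ := isClosed_frontier.exists_infDist_eq_dist hfne x
  obtain ⟨y, hy⟩ := hext z hz (infDist x (frontier Ω)) hdpos (lt_of_lt_of_le hd (min_le_left _ _))
  have hd2 : infDist x (frontier Ω) < 1 / 2 := lt_of_lt_of_le hd (min_le_right _ _)
  set d := infDist x (frontier Ω) with hddef
  have hδd : 0 < δ₁ * d := by positivity
  have hyΩ : ∀ w ∈ Ω, (δ₁ * d) ^ 2 ≤ ‖w - y‖ ^ 2 := by
    intro w hw
    have : δ₁ * d ≤ ‖w - y‖ := by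
      by_contra h
      push Not at h
      have h1 : w ∈ ball y (δ₁ * d) := by rwa [mem_ball, dist_eq_norm]
      exact (hy h1).2 (subset_closure hw)
    exact pow_le_pow_left₀ hδd.le this 2
  have hyz : dist y z < d := (hy (mem_ball_self hδd)).1
  have hxy : ‖x - y‖ ≤ 2 * d := by
    rw [← dist_eq_norm]
    have h1 := dist_triangle x z y
    rw [dist_comm z y] at h1
    linarith
  have hbar := barrier_bound hp hΩ hb hco hu hLu hbl y ((δ₁ * d) ^ 2) (by positivity) hyΩ m hm
    hmp hmG x hx
  have hspos : 0 < ‖x - y‖ ^ 2 := lt_of_lt_of_le (by positivity) (hyΩ x hx)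
  have hs4 : ‖x - y‖ ^ 2 ≤ 4 * d ^ 2 := by
    have := pow_le_pow_left₀ (norm_nonneg _) hxy 2
    linarith [this, mul_pow 2 d 2]
  have hdd : 0 < d ^ 2 := by positivity
  have g1 : (4 : ℝ) ^ (-m) * (d ^ 2) ^ (-m) ≤ (‖x - y‖ ^ 2) ^ (-m) := by
    rw [← Real.mul_rpow (by norm_num) hdd.le]
    exact Real.rpow_le_rpow_of_nonpos hspos hs4 (by linarith)
  have g2 : 2 ≤ (d ^ 2) ^ (-m) := by
    have h1 : (d ^ 2) ^ (-(1 : ℝ)) ≤ (d ^ 2) ^ (-m) :=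
      Real.rpow_le_rpow_of_exponent_ge hdd (by nlinarith) (by linarith)
    refine le_trans ?_ h1
    rw [Real.rpow_neg_one, le_inv_comm₀ (by norm_num) hdd]
    nlinarith
  have h4m : (0 : ℝ) < 4 ^ (-m) := Real.rpow_pos_of_pos (by norm_num) _
  have hDpos : 0 < (δ₁ ^ 2) ^ (m - 1 / (p - 1)) := Real.rpow_pos_of_pos (by positivity) _
  have hd3 : 0 < (d ^ 2) ^ (m - 1 / (p - 1)) := Real.rpow_pos_of_pos hdd _
  have g3 : C * (d ^ 2) ^ (-(1 / (p - 1))) ≤ u x := by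
    refine le_trans ?_ hbar
    rw [mul_pow, Real.mul_rpow (by positivity) hdd.le, hC]
    have e : (d ^ 2) ^ (-(1 / (p - 1))) = (d ^ 2) ^ (m - 1 / (p - 1)) * (d ^ 2) ^ (-m) := by
      rw [← Real.rpow_add hdd]; congr 1; ring
    rw [e]
    set X := (δ₁ ^ 2) ^ (m - 1 / (p - 1)) * (d ^ 2) ^ (m - 1 / (p - 1)) with hX
    have hXpos : 0 < X := by positivity
    have k1 : (1 / 2) * ((4 : ℝ) ^ (-m) * (d ^ 2) ^ (-m)) ≤ (‖x - y‖ ^ 2) ^ (-m) - 4 ^ (-m) := by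
      nlinarith
    have k2 := mul_le_mul_of_nonneg_left k1 hXpos.le
    calc _ = X * ((1 / 2) * ((4 : ℝ) ^ (-m) * (d ^ 2) ^ (-m))) := by rw [hX]; ring
      _ ≤ _ := k2
      _ = _ := by ring
  have hpos : 0 < (d ^ 2) ^ (-(1 / (p - 1))) := Real.rpow_pos_of_pos hdd _
  calc C ^ p / d ^ (2 * p / (p - 1)) = (C * (d ^ 2) ^ (-(1 / (p - 1)))) ^ p := by
        rw [Real.mul_rpow hCpos.le hpos.le, ← Real.rpow_natCast d 2, ← Real.rpow_mul hdpos.le,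
          ← Real.rpow_mul hdpos.le, div_eq_mul_inv, ← Real.rpow_neg hdpos.le]
        congr 2
        push_cast
        ring
    _ ≤ (max (u x) 0) ^ p :=
        Real.rpow_le_rpow (by positivity) (g3.trans (le_max_left _ _)) (by linarith)
end
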